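/- Let G be a group acting on a type α. Any ternary relation ⫶ on subsets of α satisfying invariance, extension and symmetry also satisfies normality. -/

import Mathlib

open scoped Pointwise

/-- any relation satisfying invariance, extension and symmetry
also satisfies normality. -/
theorem stmt_5 {α G : Type*} [Group G] [MulAction G α]
    (ind : Set α → Set α → Set α → Prop)
    (inv : ∀ (g : G) (A B C : Set α), ind A C B → ind (g • A) (g • C) (g • B))
    (ext : ∀ A B C Bhat : Set α, ind A C B → B ⊆ Bhat →
      ∃ (A' : Set α) (g : G), (∀ x ∈ B ∪ C, g • x = x) ∧ g • A = A' ∧ ind A' C Bhat)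
    (symm : ∀ A B C : Set α, ind A C B ↔ ind B C A) :
    ∀ A B C : Set α, ind A C B → ind (A ∪ C) C B := by
  intro A B C h
  obtain ⟨B', g, hg, rfl, h'⟩ := ext B A C (A ∪ C) ((symm _ _ _).1 h) Set.subset_union_left
  have key : ∀ S : Set α, S ⊆ A ∪ C → g⁻¹ • S = S := by
    intro S hS
    rw [inv_smul_eq_iff]
    ext x
    constructor
    · intro hx
      exact ⟨x, hx, hg x (hS hx)⟩
    · rintro ⟨y, hy, rfl⟩
      have := hg y (hS hy)
      simpa [this] using hy
  have h2 := inv g⁻¹ _ _ _ h'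
  rw [inv_smul_smul, key _ Set.subset_union_right, key _ subset_rfl] at h2
  exact (symm _ _ _).1 h2
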